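/- Let λ be a partition, let m ≥ 1 be an integer, and let s be a complex number with Re(s) > 1. For any partition μ, let {s}^μ denote the constant filling of the Young diagram of μ in which every box carries the value s. Then ζ_λ({s}^λ) · ζ(s,…,s) (with m copies of s) = Σ_μ ζ_μ({s}^μ), where the sum runs over all partitions μ containing λ with |μ| = |λ| + m such that μ/λ is a vertical strip, i.e. no two boxes of μ∖λ lie in the same row; equivalently μ_i − λ_i ∈ {0, 1} for every i. -/

import Mathlib

open scoped BigOperators

/-- The multiple zeta function `ζ(s₁,…,s_r) = Σ_{0<n₁<⋯<n_r} Π nᵢ^{-sᵢ}`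
(equal to `1` for the empty tuple). -/
noncomputable def MZV (s : List ℂ) : ℂ :=
  ∑' n : {f : Fin s.length → ℕ+ // StrictMono f},
    ∏ i : Fin s.length, (n.1 i : ℂ) ^ (-(s.get i))

/-- The multiple zeta-star function `ζ⋆(s₁,…,s_r) = Σ_{0<n₁≤⋯≤n_r} Π nᵢ^{-sᵢ}`
(equal to `1` for the empty tuple). -/
noncomputable def MZSV (s : List ℂ) : ℂ :=
  ∑' n : {f : Fin s.length → ℕ+ // Monotone f},
    ∏ i : Fin s.length, (n.1 i : ℂ) ^ (-(s.get i))

/-- The Schur multiple zeta function of shape `μ` with (0-indexed) filling `s`.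
Mathlib's semistandard Young tableaux have entries in `ℕ = {0,1,2,…}`, so the entry is
shifted by `1` to make it range over the positive integers. -/
noncomputable def schurZeta (μ : YoungDiagram) (s : ℕ → ℕ → ℂ) : ℂ :=
  ∑' T : SemistandardYoungTableau μ,
    ∏ c ∈ μ.cells, (((T c.1 c.2 + 1 : ℕ) : ℂ)) ^ (-(s c.1 c.2))

namespace YoungDiagram

theorem le_iff_rowLen_le {μ ν : YoungDiagram} : μ ≤ ν ↔ ∀ i, μ.rowLen i ≤ ν.rowLen i := by
  constructor
  · intro h i
    by_contra! hi
    exact lt_irrefl _ (mem_iff_lt_rowLen.1 (h (mem_iff_lt_rowLen.2 hi)))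
  · rintro h ⟨i, j⟩ hc
    exact mem_iff_lt_rowLen.2 ((mem_iff_lt_rowLen.1 hc).trans_le (h i))

theorem ext_rowLen {μ ν : YoungDiagram} (h : ∀ i, μ.rowLen i = ν.rowLen i) : μ = ν :=
  le_antisymm (le_iff_rowLen_le.2 fun i => (h i).le) (le_iff_rowLen_le.2 fun i => (h i).ge)

theorem exists_rowLen_eq_zero (μ : YoungDiagram) : ∃ N, ∀ i, N ≤ i → μ.rowLen i = 0 := by
  refine ⟨μ.colLen 0, fun i hi => ?_⟩
  by_contra h
  have : (i, 0) ∈ μ := mem_iff_lt_rowLen.2 (Nat.pos_of_ne_zero h)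
  exact absurd (mem_iff_lt_colLen.1 this) (not_lt.2 hi)

theorem exists_rowLen_eq {f : ℕ → ℕ} (hf : Antitone f) {N : ℕ} (hN : ∀ i, N ≤ i → f i = 0) :
    ∃ μ : YoungDiagram, ∀ i, μ.rowLen i = f i := by
  refine ⟨⟨(Finset.range N ×ˢ Finset.range (f 0)).filter fun c => c.2 < f c.1, ?_⟩, fun i => ?_⟩
  · rintro ⟨a, b⟩ ⟨a', b'⟩ hle hc
    obtain ⟨h1, h2⟩ := Prod.mk_le_mk.1 hle
    simp only [Finset.coe_filter, Finset.mem_product, Finset.mem_range, Set.mem_ofPred_eq] at hc ⊢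
    have := hf h1
    omega
  · refine eq_of_forall_lt_iff fun j => ?_
    rw [← mem_iff_lt_rowLen, ← mem_cells]
    simp only [Finset.mem_filter, Finset.mem_product, Finset.mem_range]
    have h0 := hf (Nat.zero_le i)
    have := hN i
    omega

theorem card_eq_sum_rowLen (μ : YoungDiagram) {N : ℕ} (hN : ∀ i, N ≤ i → μ.rowLen i = 0) :
    μ.cells.card = ∑ i ∈ Finset.range N, μ.rowLen i := by
  rw [Finset.card_eq_sum_card_fiberwise (f := Prod.fst) (t := Finset.range N)]
  · exact Finset.sum_congr rfl fun i _ => (rowLen_eq_card μ).symm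
  · rintro ⟨i, j⟩ hc
    have := mem_iff_lt_rowLen.1 ((mem_cells _).1 hc)
    by_contra hi
    have := hN i (by simpa using hi)
    omega

/-- `μ` is obtained from `lam` by removing a horizontal strip: the row lengths interlace. -/
def IsHorizontalStrip (lam μ : YoungDiagram) : Prop :=
  ∀ i, lam.rowLen (i + 1) ≤ μ.rowLen i ∧ μ.rowLen i ≤ lam.rowLen i

/-- `κ` is obtained from `lam` by adding a vertical strip: each row grows by at most one cell. -/
def IsVerticalStrip (κ lam : YoungDiagram) : Prop :=
  ∀ i, lam.rowLen i ≤ κ.rowLen i ∧ κ.rowLen i ≤ lam.rowLen i + 1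

theorem IsHorizontalStrip.le {lam μ : YoungDiagram} (h : lam.IsHorizontalStrip μ) : μ ≤ lam :=
  le_iff_rowLen_le.2 fun i => (h i).2

theorem IsVerticalStrip.le {κ lam : YoungDiagram} (h : κ.IsVerticalStrip lam) : lam ≤ κ :=
  le_iff_rowLen_le.2 fun i => (h i).1

theorem isHorizontalStrip_iff {lam μ : YoungDiagram} :
    lam.IsHorizontalStrip μ ↔ μ ≤ lam ∧ ∀ i j, (i + 1, j) ∈ lam → (i, j) ∈ μ := by
  refine ⟨fun h => ⟨h.le, fun i j hc => mem_iff_lt_rowLen.2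
    ((mem_iff_lt_rowLen.1 hc).trans_le (h i).1)⟩, fun h i => ⟨?_, le_iff_rowLen_le.1 h.1 i⟩⟩
  by_contra! hi
  exact lt_irrefl _ (mem_iff_lt_rowLen.1 (h.2 i _ (mem_iff_lt_rowLen.2 hi)))

theorem isVerticalStrip_iff {κ lam : YoungDiagram} :
    κ.IsVerticalStrip lam ↔ lam ≤ κ ∧ ∀ i j₁ j₂ : ℕ, (i, j₁) ∈ κ.cells → (i, j₁) ∉ lam.cells →
      (i, j₂) ∈ κ.cells → (i, j₂) ∉ lam.cells → j₁ = j₂ := by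
  simp only [mem_cells, mem_iff_lt_rowLen, not_lt]
  refine ⟨fun h => ⟨h.le, fun i j₁ j₂ h₁ h₂ h₃ h₄ => ?_⟩,
    fun h i => ⟨le_iff_rowLen_le.1 h.1 i, ?_⟩⟩
  · have := h i
    omega
  · by_contra! hi
    have := h.2 i (lam.rowLen i) (lam.rowLen i + 1) (by omega) le_rfl hi (by omega)
    omega

/-- The local growth rule: `c` carries cells down the rows, starting from `c 0 = e`. -/
def IsGrowth (lam ν μ : YoungDiagram) (e : ℕ) (κ : YoungDiagram) (c : ℕ → ℕ) : Prop :=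
  c 0 = e ∧ ∀ i,
    (ν.rowLen i ≤ lam.rowLen i →
      κ.rowLen i = lam.rowLen i + c i ∧ ν.rowLen i = μ.rowLen i + c (i + 1)) ∧
    (lam.rowLen i < ν.rowLen i →
      κ.rowLen i = ν.rowLen i ∧ μ.rowLen i = lam.rowLen i ∧ c (i + 1) = c i)

namespace IsGrowth

variable {lam ν μ μ' κ κ' : YoungDiagram} {e e' : ℕ} {c c' : ℕ → ℕ}

theorem carry_eq_zero (h : IsGrowth lam ν μ e κ c) : ∃ N, ∀ i, N ≤ i → c i = 0 := by
  obtain ⟨N, hN⟩ := ν.exists_rowLen_eq_zero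
  refine ⟨N + 1, fun i hi => ?_⟩
  obtain ⟨k, rfl⟩ : ∃ k, i = k + 1 := ⟨i - 1, by omega⟩
  have h0 := hN k (by omega)
  have := (h.2 k).1 (by omega)
  omega

theorem card_add_card (h : IsGrowth lam ν μ e κ c) :
    κ.cells.card + μ.cells.card = lam.cells.card + ν.cells.card + e := by
  obtain ⟨N₁, h₁⟩ := lam.exists_rowLen_eq_zero
  obtain ⟨N₂, h₂⟩ := ν.exists_rowLen_eq_zero
  obtain ⟨N₃, h₃⟩ := μ.exists_rowLen_eq_zero
  obtain ⟨N₄, h₄⟩ := κ.exists_rowLen_eq_zero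
  obtain ⟨N₅, h₅⟩ := h.carry_eq_zero
  set N := N₁ + N₂ + N₃ + N₄ + N₅
  rw [lam.card_eq_sum_rowLen (N := N) fun i hi => h₁ i (by omega),
    ν.card_eq_sum_rowLen (N := N) fun i hi => h₂ i (by omega),
    μ.card_eq_sum_rowLen (N := N) fun i hi => h₃ i (by omega),
    κ.card_eq_sum_rowLen (N := N) fun i hi => h₄ i (by omega)]
  have key : ∀ n, ∑ i ∈ Finset.range n, κ.rowLen i + ∑ i ∈ Finset.range n, μ.rowLen i + c n =
      ∑ i ∈ Finset.range n, lam.rowLen i + ∑ i ∈ Finset.range n, ν.rowLen i + e := by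
    intro n
    induction n with
    | zero => simp [h.1]
    | succ n ih =>
      simp only [Finset.sum_range_succ]
      have := h.2 n
      rcases le_or_gt (ν.rowLen n) (lam.rowLen n) with hn | hn
      · have := this.1 hn
        omega
      · have := this.2 hn
        omega
  have := key N
  rw [h₅ N (by omega)] at this
  omega

theorem top_unique (h : IsGrowth lam ν μ e κ c) (h' : IsGrowth lam ν μ e κ' c') : κ = κ' := by
  have hc : ∀ i, c i = c' i := by
    intro i
    induction i with
    | zero => rw [h.1, h'.1]
    | succ i ih =>
      have h1 := h.2 i
      have h2 := h'.2 i
      omega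
  refine ext_rowLen fun i => ?_
  have h1 := h.2 i
  have h2 := h'.2 i
  have := hc i
  omega

theorem bot_unique (h : IsGrowth lam ν μ e κ c) (h' : IsGrowth lam ν μ' e' κ c') :
    μ = μ' ∧ e = e' := by
  obtain ⟨N, hN⟩ := h.carry_eq_zero
  obtain ⟨N', hN'⟩ := h'.carry_eq_zero
  have hc : ∀ k i, N + N' ≤ i + k → c i = c' i := by
    intro k
    induction k with
    | zero => intro i hi; rw [hN i (by omega), hN' i (by omega)]
    | succ k ih =>
      intro i hi
      have h1 := h.2 i
      have h2 := h'.2 i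
      have := ih (i + 1) (by omega)
      omega
  refine ⟨ext_rowLen fun i => ?_, ?_⟩
  · have h1 := h.2 i
    have h2 := h'.2 i
    have := hc (N + N') (i + 1) (by omega)
    omega
  · rw [← h.1, ← h'.1]
    exact hc (N + N') 0 (by omega)

end IsGrowth

theorem exists_growth_top {lam ν μ : YoungDiagram} {e : ℕ} (he : e ≤ 1)
    (hh : lam.IsHorizontalStrip μ) (hv : ν.IsVerticalStrip μ) :
    ∃ κ c, IsGrowth lam ν μ e κ c ∧ κ.IsVerticalStrip lam ∧ κ.IsHorizontalStrip ν := by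
  let c : ℕ → ℕ := fun n => Nat.rec e
    (fun i r => if ν.rowLen i ≤ lam.rowLen i then ν.rowLen i - μ.rowLen i else r) n
  have hc0 : c 0 = e := rfl
  have hcs : ∀ i, c (i + 1) =
    if ν.rowLen i ≤ lam.rowLen i then ν.rowLen i - μ.rowLen i else c i := fun _ => rfl
  clear_value c
  have hc1 : ∀ i, c i ≤ 1 := by
    intro i
    induction i with
    | zero => omega
    | succ i ih =>
      have := hv i
      rw [hcs]
      split_ifs <;> omega
  have hlam : ∀ i, lam.rowLen (i + 1) ≤ lam.rowLen i := fun i => lam.rowLen_anti _ _ (by omega)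
  have hν : ∀ i, ν.rowLen (i + 1) ≤ ν.rowLen i := fun i => ν.rowLen_anti _ _ (by omega)
  have hcν : ∀ i, c (i + 1) + lam.rowLen (i + 1) ≤ ν.rowLen i := by
    intro i
    have h1 := hh i
    have h2 := hv i
    have h3 := hc1 i
    have h4 := hlam i
    rw [hcs]
    split_ifs <;> omega
  let f : ℕ → ℕ := fun i => if ν.rowLen i ≤ lam.rowLen i then lam.rowLen i + c i else ν.rowLen i
  have hf : ∀ i, f i = if ν.rowLen i ≤ lam.rowLen i then lam.rowLen i + c i else ν.rowLen i :=
    fun _ => rfl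
  clear_value f
  have hfν : ∀ i, ν.rowLen i ≤ f i ∧ f (i + 1) ≤ ν.rowLen i := by
    intro i
    have h1 := hcν i
    have h2 := hν i
    rw [hf, hf]
    constructor <;> split_ifs <;> omega
  obtain ⟨N, hN⟩ := ν.exists_rowLen_eq_zero
  obtain ⟨κ, hκ⟩ := exists_rowLen_eq (f := f) (N := N + 1)
    (antitone_nat_of_succ_le fun i => (hfν i).2.trans (hfν i).1) (by
      intro i hi
      obtain ⟨k, rfl⟩ : ∃ k, i = k + 1 := ⟨i - 1, by omega⟩
      have := hfν k
      have := hN k (by omega)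
      omega)
  refine ⟨κ, c, ⟨hc0, fun i => ⟨fun h => ?_, fun h => ?_⟩⟩, fun i => ?_, fun i => ?_⟩
  · rw [hκ, hf, hcs, if_pos h, if_pos h]
    have := hv i
    omega
  · rw [hκ, hf, hcs, if_neg (by omega), if_neg (by omega)]
    have := hv i
    have := hh i
    omega
  · have h1 := hc1 i
    have h2 := hv i
    have h3 := hh i
    rw [hκ, hf]
    split_ifs <;> omega
  · rw [hκ, hκ]
    have := hfν i
    omega

theorem exists_growth_bot {lam ν κ : YoungDiagram}
    (hv : κ.IsVerticalStrip lam) (hh : κ.IsHorizontalStrip ν) :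
    ∃ μ e c, IsGrowth lam ν μ e κ c ∧ e ≤ 1 ∧ lam.IsHorizontalStrip μ ∧ ν.IsVerticalStrip μ := by
  obtain ⟨N, hN⟩ := ν.exists_rowLen_eq_zero
  obtain ⟨N', hN'⟩ := κ.exists_rowLen_eq_zero
  obtain ⟨c, hc, hc1⟩ : ∃ c : ℕ → ℕ, (∀ i, c i = if ν.rowLen i ≤ lam.rowLen i then
      κ.rowLen i - lam.rowLen i else c (i + 1)) ∧ ∀ i, c i ≤ 1 := by
    have hex : ∀ i, ∃ j, i ≤ j ∧ ν.rowLen j ≤ lam.rowLen j := fun i =>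
      ⟨i + N, by omega, by rw [hN _ (by omega)]; exact Nat.zero_le _⟩
    classical
    refine ⟨fun i => κ.rowLen (Nat.find (hex i)) - lam.rowLen (Nat.find (hex i)),
      fun i => ?_, fun i => ?_⟩
    · split_ifs with h
      · have : Nat.find (hex i) = i := (Nat.find_eq_iff _).2 ⟨⟨le_rfl, h⟩, by omega⟩
        simp only [this]
      · have : Nat.find (hex i) = Nat.find (hex (i + 1)) := by
          refine le_antisymm (Nat.find_min' _ ?_) (Nat.find_min' _ ?_)
          · have := Nat.find_spec (hex (i + 1))
            exact ⟨by omega, this.2⟩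
          · have hs := Nat.find_spec (hex i)
            refine ⟨Nat.succ_le_of_lt (lt_of_le_of_ne hs.1 fun heq => h ?_), hs.2⟩
            rw [← heq] at hs
            exact hs.2
        simp only [this]
    · have := hv (Nat.find (hex i))
      dsimp only
      omega
  have hlam : ∀ i, lam.rowLen (i + 1) ≤ lam.rowLen i := fun i => lam.rowLen_anti _ _ (by omega)
  have hν : ∀ i, ν.rowLen (i + 1) ≤ ν.rowLen i := fun i => ν.rowLen_anti _ _ (by omega)
  have hcν : ∀ i, c (i + 1) + lam.rowLen (i + 1) ≤ ν.rowLen i := by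
    intro i
    have h1 := hh i
    have h2 := hh (i + 1)
    have h3 := hv (i + 1)
    have h4 := hc1 (i + 1)
    have h5 := hν i
    have h6 := hc (i + 1)
    split_ifs at h6 <;> omega
  let f : ℕ → ℕ := fun i =>
    if ν.rowLen i ≤ lam.rowLen i then ν.rowLen i - c (i + 1) else lam.rowLen i
  have hf : ∀ i, f i =
      if ν.rowLen i ≤ lam.rowLen i then ν.rowLen i - c (i + 1) else lam.rowLen i := fun _ => rfl
  clear_value f
  have hflam : ∀ i, lam.rowLen (i + 1) ≤ f i ∧ f i ≤ lam.rowLen i := by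
    intro i
    have h1 := hcν i
    have h2 := hlam i
    rw [hf]
    split_ifs <;> omega
  obtain ⟨μ, hμ⟩ := exists_rowLen_eq (f := f) (N := N')
    (antitone_nat_of_succ_le fun i => (hflam (i + 1)).2.trans (hflam i).1) (by
      intro i hi
      have := hflam i
      have := hv i
      have := hN' i hi
      omega)
  refine ⟨μ, c 0, c, ⟨rfl, fun i => ⟨fun h => ?_, fun h => ?_⟩⟩, hc1 0, fun i => ?_, fun i => ?_⟩
  · have h1 := hcν i
    have h2 := hv i
    have h3 := hc i
    rw [if_pos h] at h3
    rw [hμ, hf, if_pos h]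
    omega
  · have h1 := hv i
    have h2 := hh i
    have h3 := hc i
    rw [if_neg (by omega)] at h3
    rw [hμ, hf, if_neg (by omega)]
    omega
  · rw [hμ]
    exact hflam i
  · have h1 := hcν i
    have h2 := hv i
    have h3 := hh i
    have h4 := hc1 (i + 1)
    rw [hμ, hf]
    split_ifs <;> omega

theorem finite_setOf_card_le (n : ℕ) : {μ : YoungDiagram | μ.cells.card ≤ n}.Finite := by
  refine Set.Finite.of_finite_image (f := YoungDiagram.cells) (Set.Finite.subset
    (Finset.finite_toSet (Finset.range n ×ˢ Finset.range n).powerset) ?_) ?_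
  · rintro _ ⟨μ, hμ, rfl⟩
    simp only [Finset.coe_powerset, Set.mem_preimage, Set.mem_powerset_iff, Finset.coe_subset]
    rintro ⟨i, j⟩ hc
    have hsub : Finset.range (i + 1) ×ˢ Finset.range (j + 1) ⊆ μ.cells := by
      rintro ⟨a, b⟩ hab
      simp only [Finset.mem_product, Finset.mem_range] at hab
      exact μ.up_left_mem (by omega) (by omega) hc
    have hcard := (Finset.card_le_card hsub).trans hμ
    rw [Finset.card_product, Finset.card_range, Finset.card_range] at hcard
    simp only [Finset.mem_product, Finset.mem_range]
    constructor <;> nlinarith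
  · intro μ _ ν _ h
    exact YoungDiagram.ext h

open Classical in
/-- The diagrams obtained from `lam` by removing a horizontal strip. -/
noncomputable def removeHorizontalStrips (lam : YoungDiagram) : Finset YoungDiagram :=
  (finite_setOf_card_le lam.cells.card).toFinset.filter lam.IsHorizontalStrip

open Classical in
/-- The diagrams obtained from `lam` by adding a vertical strip with `m` cells. -/
noncomputable def addVerticalStrips (lam : YoungDiagram) (m : ℕ) : Finset YoungDiagram :=
  (finite_setOf_card_le (lam.cells.card + m)).toFinset.filter
    fun κ => κ.IsVerticalStrip lam ∧ κ.cells.card = lam.cells.card + m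

theorem IsHorizontalStrip.card_le {lam μ : YoungDiagram} (h : lam.IsHorizontalStrip μ) :
    μ.cells.card ≤ lam.cells.card :=
  Finset.card_le_card (cells_subset_iff.2 h.le)

theorem mem_removeHorizontalStrips {lam μ : YoungDiagram} :
    μ ∈ lam.removeHorizontalStrips ↔ lam.IsHorizontalStrip μ := by
  simp only [removeHorizontalStrips, Finset.mem_filter, Set.Finite.mem_toFinset,
    Set.mem_ofPred_eq, and_iff_right_iff_imp]
  exact fun h => h.card_le

theorem mem_addVerticalStrips {lam κ : YoungDiagram} {m : ℕ} :
    κ ∈ lam.addVerticalStrips m ↔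
      κ.IsVerticalStrip lam ∧ κ.cells.card = lam.cells.card + m := by
  simp only [addVerticalStrips, Finset.mem_filter, Set.Finite.mem_toFinset,
    Set.mem_ofPred_eq, and_iff_right_iff_imp]
  exact fun h => h.2.le

theorem addVerticalStrips_zero (lam : YoungDiagram) : lam.addVerticalStrips 0 = {lam} := by
  ext κ
  rw [mem_addVerticalStrips, Finset.mem_singleton]
  constructor
  · rintro ⟨h, hc⟩
    exact YoungDiagram.ext (Finset.eq_of_subset_of_card_le (cells_subset_iff.2 h.le) hc.le).symm
  · rintro rfl
    exact ⟨fun i => ⟨le_rfl, Nat.le_succ _⟩, rfl⟩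

/-- Removing a horizontal strip and then adding a vertical strip commutes with the opposite order
of operations, up to one extra cell `e`. -/
theorem sum_horizontal_vertical {R : Type*} [CommSemiring R] (P : YoungDiagram → R) (y : R)
    (lam : YoungDiagram) (m : ℕ) :
    ∑ μ ∈ lam.removeHorizontalStrips, ∑ e ∈ Finset.range 2,
      ∑ ν ∈ μ.addVerticalStrips (m + 1 - e), y ^ (lam.cells.card - μ.cells.card + e) * P ν =
    ∑ κ ∈ lam.addVerticalStrips (m + 1), ∑ ν ∈ κ.removeHorizontalStrips,
      y ^ (κ.cells.card - ν.cells.card) * P ν := by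
  simp only [Finset.sum_sigma']
  have hex : ∀ a ∈ (lam.removeHorizontalStrips.sigma fun μ => (Finset.range 2).sigma fun e =>
      μ.addVerticalStrips (m + 1 - e)), ∃ κ c, IsGrowth lam a.2.2 a.1 a.2.1 κ c ∧
      κ.IsVerticalStrip lam ∧ κ.IsHorizontalStrip a.2.2 := by
    rintro ⟨μ, e, ν⟩ ha
    simp only [Finset.mem_sigma, mem_removeHorizontalStrips, mem_addVerticalStrips,
      Finset.mem_range] at ha
    exact exists_growth_top (Nat.le_of_lt_succ ha.2.1) ha.1 ha.2.2.1
  choose κ c hg hv hh using hex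
  refine Finset.sum_bij (fun a ha => ⟨κ a ha, a.2.2⟩) ?_ ?_ ?_ ?_
  · rintro ⟨μ, e, ν⟩ ha
    have hcard := (hg _ ha).card_add_card
    simp only [Finset.mem_sigma, mem_removeHorizontalStrips, mem_addVerticalStrips]
    refine ⟨⟨hv _ ha, ?_⟩, hh _ ha⟩
    simp only [Finset.mem_sigma, mem_addVerticalStrips, Finset.mem_range] at ha
    dsimp only at hcard
    omega
  · rintro ⟨μ, e, ν⟩ ha ⟨μ', e', ν'⟩ ha' heq
    simp only [Sigma.mk.injEq, heq_eq_eq] at heq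
    obtain ⟨h1, rfl⟩ := heq
    have g := hg _ ha
    rw [h1] at g
    obtain ⟨h2, h3⟩ := g.bot_unique (hg _ ha')
    dsimp only at h2 h3
    rw [h2, h3]
  · rintro ⟨κ₀, ν⟩ hb
    simp only [Finset.mem_sigma, mem_removeHorizontalStrips, mem_addVerticalStrips] at hb
    obtain ⟨μ, e, c₀, g, he, hh', hv'⟩ := exists_growth_bot hb.1.1 hb.2
    have hcard := g.card_add_card
    have ha : (⟨μ, e, ν⟩ : Σ _ : YoungDiagram, Σ _ : ℕ, YoungDiagram) ∈
        (lam.removeHorizontalStrips.sigma fun μ => (Finset.range 2).sigma fun e =>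
          μ.addVerticalStrips (m + 1 - e)) := by
      simp only [Finset.mem_sigma, mem_removeHorizontalStrips, mem_addVerticalStrips,
        Finset.mem_range]
      exact ⟨hh', by omega, hv', by omega⟩
    exact ⟨_, ha, by rw [(hg _ ha).top_unique g]⟩
  · rintro ⟨μ, e, ν⟩ ha
    have hcard := (hg _ ha).card_add_card
    have h1 := (hh _ ha).card_le
    simp only [Finset.mem_sigma, mem_removeHorizontalStrips] at ha
    have h2 := ha.1.card_le
    dsimp only at hcard h1 ⊢
    congr 2
    omega

end YoungDiagram

/-- The elementary symmetric polynomial of degree `m` in the first `N` variables. -/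
def elemSum {R : Type*} [CommSemiring R] (x : ℕ → R) (N m : ℕ) : R :=
  ∑ t ∈ (Finset.range N).powersetCard m, ∏ i ∈ t, x i

section

variable {R : Type*} [CommSemiring R] (x : ℕ → R)

theorem elemSum_zero_right (N : ℕ) : elemSum x N 0 = 1 := by
  simp [elemSum]

theorem elemSum_zero_succ (m : ℕ) : elemSum x 0 (m + 1) = 0 := by
  rw [elemSum, Finset.powersetCard_eq_empty.2 (by simp), Finset.sum_empty]

theorem elemSum_succ_succ (N m : ℕ) :
    elemSum x (N + 1) (m + 1) = elemSum x N (m + 1) + x N * elemSum x N m := by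
  have hN : ∀ t ∈ (Finset.range N).powersetCard m, N ∉ t := fun t ht h => by
    simpa using (Finset.mem_powersetCard.1 ht).1 h
  rw [elemSum, Finset.range_add_one, Finset.powersetCard_succ_insert Finset.notMem_range_self,
    Finset.sum_union, Finset.sum_image, elemSum, elemSum, Finset.mul_sum]
  · exact congrArg _ (Finset.sum_congr rfl fun t ht => Finset.prod_insert (hN t ht))
  · intro t ht t' ht' h
    rw [← Finset.erase_insert (hN t ht), h, Finset.erase_insert (hN t' ht')]
  · rw [Finset.disjoint_left]
    intro t ht ht'
    obtain ⟨t', _, rfl⟩ := Finset.mem_image.1 ht'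
    simpa using (Finset.mem_powersetCard.1 ht).1 (Finset.mem_insert_self N t')

end

namespace SemistandardYoungTableau

open YoungDiagram

theorem injective_entries (μ : YoungDiagram) : Function.Injective
    fun (T : SemistandardYoungTableau μ) (c : μ.cells) => T c.1.1 c.1.2 := by
  intro T T' h
  ext i j
  by_cases hc : (i, j) ∈ μ
  · exact congrFun h ⟨(i, j), hc⟩
  · rw [T.zeros hc, T'.zeros hc]

theorem finite_setOf_lt (μ : YoungDiagram) (N : ℕ) :
    {T : SemistandardYoungTableau μ | ∀ c ∈ μ.cells, T c.1 c.2 < N}.Finite := by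
  refine ((Fintype.piFinset fun _ : μ.cells => Finset.range N).finite_toSet.preimage
    (injective_entries μ).injOn).subset fun T hT => ?_
  simpa [Fintype.mem_piFinset] using hT

/-- The semistandard tableaux of shape `μ` all of whose entries are smaller than `N`. -/
noncomputable def bounded (μ : YoungDiagram) (N : ℕ) : Finset (SemistandardYoungTableau μ) :=
  (finite_setOf_lt μ N).toFinset

theorem mem_bounded {μ : YoungDiagram} {N : ℕ} {T : SemistandardYoungTableau μ} :
    T ∈ bounded μ N ↔ ∀ c ∈ μ.cells, T c.1 c.2 < N := by
  simp [bounded]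

/-- Fill the cells of the horizontal strip `lam / μ` by `N`. -/
def extend {lam μ : YoungDiagram} (h : lam.IsHorizontalStrip μ) {N : ℕ}
    (T : SemistandardYoungTableau μ) (hT : ∀ c ∈ μ.cells, T c.1 c.2 < N) :
    SemistandardYoungTableau lam where
  entry i j := if (i, j) ∈ μ then T i j else if (i, j) ∈ lam then N else 0
  row_weak' {i j₁ j₂} hj hc := by
    rw [if_pos hc]
    by_cases h₂ : (i, j₂) ∈ μ
    · rw [if_pos h₂, if_pos (μ.up_left_mem le_rfl hj.le h₂)]
      exact T.row_weak hj h₂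
    · rw [if_neg h₂]
      split_ifs with h₁
      · exact (hT _ h₁).le
      · exact le_rfl
      · exact Nat.zero_le _
  col_strict' {i₁ i₂ j} hi hc := by
    have h₁ : (i₁, j) ∈ μ :=
      (isHorizontalStrip_iff.1 h).2 _ _ (lam.up_left_mem (Nat.succ_le_of_lt hi) le_rfl hc)
    rw [if_pos h₁, if_pos hc]
    split_ifs with h₂
    · exact T.col_strict hi h₂
    · exact hT _ h₁
  zeros' {i j} hc := by
    rw [if_neg fun h' => hc (h.le h'), if_neg hc]

theorem extend_apply {lam μ : YoungDiagram} (h : lam.IsHorizontalStrip μ) {N : ℕ}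
    (T : SemistandardYoungTableau μ) (hT : ∀ c ∈ μ.cells, T c.1 c.2 < N) (i j : ℕ) :
    extend h T hT i j = if (i, j) ∈ μ then T i j else if (i, j) ∈ lam then N else 0 :=
  rfl

theorem mem_iff_extend_lt {lam μ : YoungDiagram} (h : lam.IsHorizontalStrip μ) {N : ℕ}
    (T : SemistandardYoungTableau μ) (hT : ∀ c ∈ μ.cells, T c.1 c.2 < N) {i j : ℕ} :
    (i, j) ∈ μ ↔ (i, j) ∈ lam ∧ extend h T hT i j < N := by
  rw [extend_apply]
  constructor
  · intro hc
    rw [if_pos hc]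
    exact ⟨h.le hc, hT _ hc⟩
  · rintro ⟨hc, hlt⟩
    by_contra hμ
    rw [if_neg hμ, if_pos hc] at hlt
    exact lt_irrefl _ hlt

theorem exists_extend_eq {lam : YoungDiagram} {N : ℕ} (T : SemistandardYoungTableau lam)
    (hT : ∀ c ∈ lam.cells, T c.1 c.2 < N + 1) :
    ∃ (μ : YoungDiagram) (h : lam.IsHorizontalStrip μ) (T' : SemistandardYoungTableau μ)
      (hT' : ∀ c ∈ μ.cells, T' c.1 c.2 < N), extend h T' hT' = T := by
  let μ : YoungDiagram := ⟨lam.cells.filter fun c => T c.1 c.2 < N, by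
    rintro ⟨a, b⟩ ⟨a', b'⟩ hle hc
    obtain ⟨h1, h2⟩ := Prod.mk_le_mk.1 hle
    simp only [Finset.coe_filter, Set.mem_ofPred_eq, mem_cells] at hc ⊢
    exact ⟨lam.up_left_mem h1 h2 hc.1, ((T.row_weak_of_le h2
      (lam.up_left_mem h1 le_rfl hc.1)).trans (T.col_weak h1 hc.1)).trans_lt hc.2⟩⟩
  have hμ : ∀ {i j : ℕ}, (i, j) ∈ μ ↔ (i, j) ∈ lam ∧ T i j < N := fun {i j} => by
    rw [← mem_cells]
    exact Finset.mem_filter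
  clear_value μ
  refine ⟨μ, isHorizontalStrip_iff.2 ⟨fun c hc => (hμ.1 hc).1, fun i j hc => hμ.2
      ⟨lam.up_left_mem (Nat.le_succ _) le_rfl hc, ?_⟩⟩,
    ⟨fun i j => if (i, j) ∈ μ then T i j else 0, ?_, ?_, fun hc => if_neg hc⟩, ?_, ?_⟩
  · exact (T.col_strict (Nat.lt_succ_self i) hc).trans_le (Nat.le_of_lt_succ (hT _ hc))
  · intro i j₁ j₂ hj hc
    rw [if_pos hc, if_pos (μ.up_left_mem le_rfl hj.le hc)]
    exact T.row_weak hj (hμ.1 hc).1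
  · intro i₁ i₂ j hi hc
    rw [if_pos hc, if_pos (μ.up_left_mem hi.le le_rfl hc)]
    exact T.col_strict hi (hμ.1 hc).1
  · rintro ⟨i, j⟩ hc
    exact (if_pos hc).trans_lt (hμ.1 hc).2
  · ext i j
    rw [extend_apply]
    by_cases hc : (i, j) ∈ μ
    · rw [if_pos hc]
      exact if_pos hc
    · rw [if_neg hc]
      split_ifs with hl
      · have h1 : T i j < N + 1 := hT _ hl
        have h2 : ¬ T i j < N := fun h => hc (hμ.2 ⟨hl, h⟩)
        omega
      · exact (T.zeros hl).symm

/-- The Schur polynomial of shape `μ` in the first `N` of the variables `x 0, x 1, …`. -/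
noncomputable def schurSum {R : Type*} [CommSemiring R] (x : ℕ → R) (N : ℕ) (μ : YoungDiagram) :
    R :=
  ∑ T ∈ bounded μ N, ∏ c ∈ μ.cells, x (T c.1 c.2)

variable {R : Type*} [CommSemiring R] (x : ℕ → R)

theorem prod_extend {lam μ : YoungDiagram} (h : lam.IsHorizontalStrip μ) {N : ℕ}
    (T : SemistandardYoungTableau μ) (hT : ∀ c ∈ μ.cells, T c.1 c.2 < N) :
    ∏ c ∈ lam.cells, x (extend h T hT c.1 c.2) =
      x N ^ (lam.cells.card - μ.cells.card) * ∏ c ∈ μ.cells, x (T c.1 c.2) := by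
  have hsub := cells_subset_iff.2 h.le
  rw [← Finset.prod_sdiff hsub, ← Finset.card_sdiff_of_subset hsub]
  congr 1
  · refine Finset.prod_eq_pow_card fun c hc => ?_
    rw [Finset.mem_sdiff] at hc
    rw [extend_apply, if_neg (by exact hc.2), if_pos (by exact hc.1)]
  · refine Finset.prod_congr rfl fun c hc => ?_
    rw [extend_apply, if_pos (by exact hc)]

theorem schurSum_succ (N : ℕ) (lam : YoungDiagram) :
    schurSum x (N + 1) lam = ∑ μ ∈ lam.removeHorizontalStrips,
      x N ^ (lam.cells.card - μ.cells.card) * schurSum x N μ := by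
  simp only [schurSum, Finset.mul_sum, Finset.sum_sigma']
  symm
  have hmem : ∀ a ∈ lam.removeHorizontalStrips.sigma fun μ => bounded μ N,
      lam.IsHorizontalStrip a.1 ∧ ∀ c ∈ a.1.cells, a.2 c.1 c.2 < N := by
    intro a ha
    rwa [Finset.mem_sigma, mem_removeHorizontalStrips, mem_bounded] at ha
  refine Finset.sum_bij (fun a ha => extend (hmem a ha).1 a.2 (hmem a ha).2) ?_ ?_ ?_ ?_
  · intro a ha
    refine mem_bounded.2 fun c hc => ?_
    rw [extend_apply]
    split_ifs with h
    · exact ((hmem a ha).2 c h).trans (Nat.lt_succ_self N)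
    · exact Nat.lt_succ_self N
    · exact Nat.succ_pos N
  · rintro ⟨μ, T⟩ ha ⟨μ', T'⟩ ha' heq
    have h := hmem _ ha
    have h' := hmem _ ha'
    dsimp only at h h' heq
    obtain rfl : μ = μ' := by
      refine SetLike.ext fun c => ?_
      rw [mem_iff_extend_lt h.1 T h.2, mem_iff_extend_lt h'.1 T' h'.2, heq]
    congr 1
    ext i j
    by_cases hc : (i, j) ∈ μ
    · have := congrArg (fun S : SemistandardYoungTableau lam => S i j) heq
      simpa only [extend_apply, if_pos hc] using this
    · rw [T.zeros hc, T'.zeros hc]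
  · intro T hT
    obtain ⟨μ, h, T', hT', rfl⟩ := exists_extend_eq T (mem_bounded.1 hT)
    exact ⟨⟨μ, T'⟩, Finset.mem_sigma.2 ⟨mem_removeHorizontalStrips.2 h, mem_bounded.2 hT'⟩, rfl⟩
  · intro a ha
    rw [prod_extend]

theorem schurSum_zero_of_card_pos {μ : YoungDiagram} (h : 0 < μ.cells.card) :
    schurSum x 0 μ = 0 := by
  obtain ⟨c, hc⟩ := Finset.card_pos.1 h
  refine Finset.sum_eq_zero fun T hT => ?_
  exact absurd (mem_bounded.1 hT c hc) (Nat.not_lt_zero _)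

/-- The Pieri rule for Schur polynomials in finitely many variables. -/
theorem schurSum_mul_elemSum (N : ℕ) : ∀ (lam : YoungDiagram) (m : ℕ),
    schurSum x N lam * elemSum x N m = ∑ κ ∈ lam.addVerticalStrips m, schurSum x N κ := by
  induction N with
  | zero =>
    rintro lam (_ | m)
    · rw [elemSum_zero_right, mul_one, addVerticalStrips_zero, Finset.sum_singleton]
    · rw [elemSum_zero_succ, mul_zero]
      refine (Finset.sum_eq_zero fun κ hκ => schurSum_zero_of_card_pos x ?_).symm
      rw [(mem_addVerticalStrips.1 hκ).2]
      omega
  | succ N ih =>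
    rintro lam (_ | m)
    · rw [elemSum_zero_right, mul_one, addVerticalStrips_zero, Finset.sum_singleton]
    · simp only [schurSum_succ x N]
      rw [← sum_horizontal_vertical, Finset.sum_mul]
      refine Finset.sum_congr rfl fun μ _ => ?_
      simp only [← Finset.mul_sum, ← ih, Finset.sum_range_succ, Finset.sum_range_zero,
        elemSum_succ_succ, Nat.add_sub_cancel, Nat.sub_zero, pow_add, pow_zero, pow_one]
      ring

end SemistandardYoungTableau

open Filter Topology

theorem summable_norm_prod_pi {ι : Type*} [Fintype ι] {x : ℕ → ℂ} (hx : Summable fun n => ‖x n‖) :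
    Summable fun f : ι → ℕ => ‖∏ i, x (f i)‖ := by
  classical
  refine summable_of_sum_le (c := ∏ _i : ι, ∑' n, ‖x n‖) (fun _ => norm_nonneg _) fun u => ?_
  calc ∑ f ∈ u, ‖∏ i, x (f i)‖
      ≤ ∑ f ∈ Fintype.piFinset fun i => u.image fun f => f i, ‖∏ i, x (f i)‖ :=
        Finset.sum_le_sum_of_subset_of_nonneg (fun f hf => Fintype.mem_piFinset.2 fun i =>
          Finset.mem_image_of_mem _ hf) fun _ _ _ => norm_nonneg _
    _ = ∏ i, ∑ n ∈ u.image fun f => f i, ‖x n‖ := by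
        simp only [norm_prod, Finset.prod_univ_sum]
    _ ≤ ∏ _i : ι, ∑' n, ‖x n‖ :=
        Finset.prod_le_prod (fun _ _ => Finset.sum_nonneg fun _ _ => norm_nonneg _)
          fun i _ => hx.sum_le_tsum _ fun _ _ => norm_nonneg _

theorem SemistandardYoungTableau.tendsto_schurSum {x : ℕ → ℂ} (hx : Summable fun n => ‖x n‖)
    (μ : YoungDiagram) :
    Tendsto (fun N => schurSum x N μ) atTop
      (𝓝 (∑' T : SemistandardYoungTableau μ, ∏ c ∈ μ.cells, x (T c.1 c.2))) := by
  have hs : Summable fun T : SemistandardYoungTableau μ => ∏ c ∈ μ.cells, x (T c.1 c.2) := by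
    refine Summable.of_norm (((summable_norm_prod_pi hx).comp_injective
      (injective_entries μ)).congr fun T => ?_)
    rw [← Finset.prod_coe_sort]
    rfl
  refine hs.hasSum.comp (tendsto_atTop_finset_of_monotone (fun N N' h T hT => ?_) fun T => ?_)
  · exact mem_bounded.2 fun c hc => (mem_bounded.1 hT c hc).trans_le h
  · exact ⟨μ.cells.sup (fun c => T c.1 c.2) + 1, mem_bounded.2 fun c hc =>
      Nat.lt_succ_of_le (Finset.le_sup (f := fun c : ℕ × ℕ => T c.1 c.2) hc)⟩

theorem finite_setOf_natPred_lt (m N : ℕ) :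
    {f : {f : Fin m → ℕ+ // StrictMono f} | ∀ i, (f.1 i).natPred < N}.Finite := by
  refine ((Fintype.piFinset fun _ : Fin m => Finset.range N).finite_toSet.preimage
    (f := fun (f : {f : Fin m → ℕ+ // StrictMono f}) i => (f.1 i).natPred) ?_).subset
    fun f hf => ?_
  · intro f _ g _ h
    exact Subtype.ext (funext fun i => PNat.natPred_injective (congrFun h i))
  · simpa [Fintype.mem_piFinset] using hf

theorem elemSum_eq_sum_strictMono (x : ℕ → ℂ) (N m : ℕ) :
    elemSum x N m =
      ∑ f ∈ (finite_setOf_natPred_lt m N).toFinset, ∏ i, x (f.1 i).natPred := by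
  have hmono : ∀ f : {f : Fin m → ℕ+ // StrictMono f}, StrictMono fun i => (f.1 i).natPred :=
    fun f => PNat.natPred_strictMono.comp f.2
  symm
  refine Finset.sum_bij (fun f _ => Finset.univ.image fun i => (f.1 i).natPred) ?_ ?_ ?_ ?_
  · intro f hf
    rw [Finset.mem_powersetCard, Finset.card_image_of_injective _ (hmono f).injective]
    refine ⟨fun k hk => ?_, by simp⟩
    obtain ⟨i, _, rfl⟩ := Finset.mem_image.1 hk
    exact Finset.mem_range.2 ((Set.Finite.mem_toFinset _).1 hf i)
  · intro f _ g _ h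
    have h' := congrArg (fun t : Finset ℕ => (t : Set ℕ)) h
    simp only [Finset.coe_image, Finset.coe_univ, Set.image_univ] at h'
    have := (StrictMono.range_inj (hmono f) (hmono g)).1 h'
    exact Subtype.ext (funext fun i => PNat.natPred_injective (congrFun this i))
  · intro t ht
    rw [Finset.mem_powersetCard] at ht
    refine ⟨⟨fun i => (t.orderEmbOfFin ht.2 i).succPNat,
      Nat.succPNat_strictMono.comp (t.orderEmbOfFin ht.2).strictMono⟩, ?_, ?_⟩
    · rw [Set.Finite.mem_toFinset]
      intro i
      simpa using ht.1 (t.orderEmbOfFin_mem ht.2 i)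
    · simp only [Nat.natPred_succPNat]
      exact t.image_orderEmbOfFin_univ ht.2
  · intro f _
    rw [Finset.prod_image fun i _ j _ h => (hmono f).injective h]

theorem tendsto_elemSum {x : ℕ → ℂ} (hx : Summable fun n => ‖x n‖) (m : ℕ) :
    Tendsto (fun N => elemSum x N m) atTop
      (𝓝 (∑' f : {f : Fin m → ℕ+ // StrictMono f}, ∏ i, x (f.1 i).natPred)) := by
  have hs : Summable fun f : {f : Fin m → ℕ+ // StrictMono f} => ∏ i, x (f.1 i).natPred :=
    Summable.of_norm ((summable_norm_prod_pi hx).comp_injective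
      (i := fun (f : {f : Fin m → ℕ+ // StrictMono f}) i => (f.1 i).natPred)
      fun f g h => Subtype.ext (funext fun i => PNat.natPred_injective (congrFun h i)))
  simp only [elemSum_eq_sum_strictMono]
  refine hs.hasSum.comp (tendsto_atTop_finset_of_monotone (fun N N' h f hf => ?_) fun f => ?_)
  · rw [Set.Finite.mem_toFinset] at hf ⊢
    exact fun i => (hf i).trans_le h
  · refine ⟨Finset.univ.sup (fun i => (f.1 i).natPred) + 1, ?_⟩
    rw [Set.Finite.mem_toFinset]
    exact fun i => Nat.lt_succ_of_le
      (Finset.le_sup (f := fun i => (f.1 i).natPred) (Finset.mem_univ i))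

theorem MZV_replicate (m : ℕ) (s : ℂ) : MZV (List.replicate m s) =
    ∑' f : {f : Fin m → ℕ+ // StrictMono f},
      ∏ i, (((f.1 i).natPred + 1 : ℕ) : ℂ) ^ (-s) := by
  have key : ∀ (l : List ℂ) (k : ℕ), l.length = k → (∀ i, l.get i = s) → MZV l =
      ∑' f : {f : Fin k → ℕ+ // StrictMono f},
        ∏ i, (((f.1 i).natPred + 1 : ℕ) : ℂ) ^ (-s) := by
    rintro l _ rfl hl
    simp only [MZV, hl, PNat.natPred_add_one]
  exact key _ _ List.length_replicate fun i => by
    rw [List.get_eq_getElem, List.getElem_replicate]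

theorem summable_norm_succ_cpow {s : ℂ} (hs : 1 < s.re) :
    Summable fun n : ℕ => ‖((n + 1 : ℕ) : ℂ) ^ (-s)‖ := by
  simp only [Complex.norm_natCast_cpow_of_pos (Nat.succ_pos _), Complex.neg_re]
  exact (summable_nat_add_iff 1).2 (Real.summable_nat_rpow.2 (by linarith))

/-- the Pieri formula for Schur multiple zeta functions with all variables
equal to `s` : multiplying by `ζ(s,…,s)` (`m` copies) adds a vertical strip of `m`
boxes in all possible ways. -/
theorem stmt12 (lam : YoungDiagram) (m : ℕ) (hm : 1 ≤ m) (s : ℂ) (hs : 1 < s.re) :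
    schurZeta lam (fun _ _ => s) * MZV (List.replicate m s)
    = ∑' mu : {mu : YoungDiagram // lam ≤ mu ∧ mu.cells.card = lam.cells.card + m ∧
        ∀ i j₁ j₂ : ℕ, (i, j₁) ∈ mu.cells → (i, j₁) ∉ lam.cells →
          (i, j₂) ∈ mu.cells → (i, j₂) ∉ lam.cells → j₁ = j₂},
        schurZeta mu.1 (fun _ _ => s) := by
  have hx := summable_norm_succ_cpow hs
  have hlhs := (SemistandardYoungTableau.tendsto_schurSum hx lam).mul (tendsto_elemSum hx m)
  simp only [SemistandardYoungTableau.schurSum_mul_elemSum] at hlhs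
  have hrhs := tendsto_finsetSum (lam.addVerticalStrips m) fun κ _ =>
    SemistandardYoungTableau.tendsto_schurSum hx κ
  rw [MZV_replicate, schurZeta, tendsto_nhds_unique hlhs hrhs, ← Finset.tsum_subtype]
  have hiff : ∀ κ : YoungDiagram, κ ∈ lam.addVerticalStrips m ↔
      lam ≤ κ ∧ κ.cells.card = lam.cells.card + m ∧
        ∀ i j₁ j₂ : ℕ, (i, j₁) ∈ κ.cells → (i, j₁) ∉ lam.cells →
          (i, j₂) ∈ κ.cells → (i, j₂) ∉ lam.cells → j₁ = j₂ := fun κ => by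
    rw [YoungDiagram.mem_addVerticalStrips, YoungDiagram.isVerticalStrip_iff, and_assoc,
      and_comm (a := κ.cells.card = _)]
  exact (Equiv.subtypeEquivRight hiff).tsum_eq fun κ => schurZeta κ.1 fun _ _ => s
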